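/- arXiv:1106.2461 — 2 statements merged into one kernel-verified Lean document; each statement's English description precedes it below -/
import Mathlib

section
/- Let S ∈ B⁰(H) satisfy both: (i) ‖W(x,0) S − S‖ → 0 and ‖W(x,0) S* − S*‖ → 0 as x → 0 in ℝⁿ, and (ii) ‖W(0,ξ) S − S‖ → 0 and ‖W(0,ξ) S* − S*‖ → 0 as ξ → 0 in ℝⁿ. Then S is a compact operator. Conversely, every compact operator S on H satisfies S ∈ B⁰(H) together with conditions (i) and (ii). In other words, E(H) ∩ F(H) equals the ideal of compact operators on H. -/
open MeasureTheory Filter Topology Matrix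
open scoped Pointwise

noncomputable section

/-- Phase space `Ξ = ℝⁿ × (ℝⁿ)*`. -/
abbrev Xi (n : ℕ) := (Fin n → ℝ) × (Fin n → ℝ)

/-- The Hilbert space `H = L²(ℝⁿ, ℂ)`. -/
abbrev Hn (n : ℕ) := Lp ℂ 2 (volume : Measure (Fin n → ℝ))

/-- `W` is the family of operators given by
`(W(x,ξ)u)(y) = exp(i (y - x/2)·ξ) u(y - x)` (almost everywhere). -/
def IsWeylFamily (n : ℕ) (W : Xi n → (Hn n →L[ℂ] Hn n)) : Prop :=
  ∀ (x ξ : Fin n → ℝ) (u : Hn n), ∀ᵐ y ∂(volume : Measure (Fin n → ℝ)),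
    W (x, ξ) u y
      = Complex.exp (Complex.I * (((y - (2⁻¹ : ℝ) • x) ⬝ᵥ ξ : ℝ) : ℂ)) * u (y - x)

/-- Conjugation `T_X(S) := W(X) S W(X)*`. -/
def Tconj (n : ℕ) (W : Xi n → (Hn n →L[ℂ] Hn n)) (X : Xi n)
    (S : Hn n →L[ℂ] Hn n) : Hn n →L[ℂ] Hn n :=
  W X * S * star (W X)

/-- `B⁰(H)`: the set of `S` whose orbit `X ↦ T_X(S)` is norm-continuous. -/
def B0 (n : ℕ) (W : Xi n → (Hn n →L[ℂ] Hn n)) : Set (Hn n →L[ℂ] Hn n) :=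
  {S | Continuous fun X : Xi n => Tconj n W X S}

theorem eLpNorm_two_sq_eq_lintegral {Y F : Type*} [MeasurableSpace Y] [NormedAddCommGroup F]
    (μ : Measure Y) (f : Y → F) : eLpNorm f 2 μ ^ 2 = ∫⁻ y, ‖f y‖ₑ ^ 2 ∂μ := by
  simpa using eLpNorm_nnreal_pow_eq_lintegral (μ := μ) (f := f) (p := 2) two_ne_zero

/-- Minkowski's integral inequality in `L²` for averages over a probability measure. -/
theorem eLpNorm_integral_le_of_forall_eLpNorm_le {X Y : Type*} [MeasurableSpace X]
    [MeasurableSpace Y] {ν : Measure X} [IsProbabilityMeasure ν] {μ : Measure Y} [SFinite μ]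
    {h : X → Y → ℂ} (hm : StronglyMeasurable (Function.uncurry h)) {C : ENNReal}
    (hC : ∀ᵐ x ∂ν, eLpNorm (h x) 2 μ ≤ C) :
    eLpNorm (fun y => ∫ x, h x y ∂ν) 2 μ ≤ C := by
  rw [← ENNReal.pow_le_pow_left_iff (two_ne_zero), eLpNorm_two_sq_eq_lintegral]
  calc ∫⁻ y, ‖∫ x, h x y ∂ν‖ₑ ^ 2 ∂μ
      ≤ ∫⁻ y, ∫⁻ x, ‖h x y‖ₑ ^ 2 ∂ν ∂μ := by
        refine lintegral_mono fun y => ?_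
        have hy : AEStronglyMeasurable (fun x => h x y) ν :=
          (hm.comp_measurable measurable_prodMk_right).aestronglyMeasurable
        rw [← eLpNorm_two_sq_eq_lintegral]
        gcongr
        refine (enorm_integral_le_lintegral_enorm _).trans ?_
        rw [← eLpNorm_one_eq_lintegral_enorm]
        exact eLpNorm_le_eLpNorm_of_exponent_le (by norm_num) hy
    _ = ∫⁻ x, ∫⁻ y, ‖h x y‖ₑ ^ 2 ∂μ ∂ν := by
        refine lintegral_lintegral_swap ?_
        exact ((hm.comp_measurable measurable_swap).enorm.pow_const 2).aemeasurable
    _ ≤ ∫⁻ x, C ^ 2 ∂ν := by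
        refine lintegral_mono_ae ?_
        filter_upwards [hC] with x hx
        rw [← eLpNorm_two_sq_eq_lintegral]
        gcongr
    _ = C ^ 2 := by simp

/-- A strongly continuous family of contractions is norm continuous after multiplication on the
right by a compact operator. -/
theorem continuous_mul_of_isCompactOperator {X H : Type*} [TopologicalSpace X]
    [NormedAddCommGroup H] [NormedSpace ℂ H] {V : X → H →L[ℂ] H}
    (hV : ∀ x u, ‖V x u‖ ≤ ‖u‖) (hc : ∀ u, Continuous fun x => V x u)
    {S : H →L[ℂ] H} (hS : IsCompactOperator S) : Continuous fun x => V x * S := by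
  rw [continuous_iff_continuousAt]
  intro x₀
  rw [ContinuousAt, Metric.tendsto_nhds]
  intro ε hε
  have htb : TotallyBounded (S '' Metric.closedBall 0 1) :=
    (hS.isCompact_closure_image_closedBall (f := (S : H →ₗ[ℂ] H)) 1).totallyBounded.subset
      subset_closure
  obtain ⟨t, htf, ht⟩ := Metric.totallyBounded_iff.1 htb (ε / 6) (by positivity)
  have hev : ∀ᶠ x in 𝓝 x₀, ∀ v ∈ t, dist (V x v) (V x₀ v) < ε / 6 :=
    (Filter.eventually_all_finite htf).2 fun v _ =>
      Metric.tendsto_nhds.1 (hc v).continuousAt _ (by positivity)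
  filter_upwards [hev] with x hx
  rw [dist_eq_norm]
  refine lt_of_le_of_lt (ContinuousLinearMap.opNorm_le_of_unit_norm (C := ε / 2) (by positivity)
    fun u hu => ?_) (by linarith)
  obtain ⟨v, hvt, hv⟩ : ∃ v ∈ t, S u ∈ Metric.ball v (ε / 6) := by
    simpa using ht ⟨u, by simp [hu], rfl⟩
  have h1 : ‖V x (S u - v)‖ < ε / 6 := (hV _ _).trans_lt (by simpa [dist_eq_norm] using hv)
  have h2 : ‖V x₀ (S u - v)‖ < ε / 6 := (hV _ _).trans_lt (by simpa [dist_eq_norm] using hv)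
  have h3 := hx v hvt
  rw [dist_eq_norm] at h3
  have h4 : (V x * S - V x₀ * S) u = V x (S u - v) + (V x v - V x₀ v) - V x₀ (S u - v) := by
    simp
  rw [h4]
  have := norm_sub_le (V x (S u - v) + (V x v - V x₀ v)) (V x₀ (S u - v))
  have := norm_add_le (V x (S u - v)) (V x v - V x₀ v)
  linarith

/-- Schauder's theorem in a Hilbert space. -/
theorem isCompactOperator_star {H : Type*} [NormedAddCommGroup H] [InnerProductSpace ℂ H]
    [CompleteSpace H] {S : H →L[ℂ] H} (hS : IsCompactOperator S) :
    IsCompactOperator (star S : H →L[ℂ] H) := by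
  have hc : IsCompactOperator (S ∘L star S) := hS.comp_clm (star S)
  have htb : TotallyBounded ((S ∘L star S) '' Metric.closedBall 0 1) :=
    (hc.isCompact_closure_image_closedBall
      (f := ((S ∘L star S : H →L[ℂ] H) : H →ₗ[ℂ] H)) 1).totallyBounded.subset subset_closure
  refine (isCompactOperator_iff_isCompact_closure_image_closedBall
    ((star S : H →L[ℂ] H) : H →ₗ[ℂ] H) one_pos).2 ?_
  refine (TotallyBounded.closure ?_).isCompact_of_isClosed isClosed_closure
  rw [Metric.totallyBounded_iff]
  intro ε hε
  obtain ⟨t, hts, htf, ht⟩ := Metric.finite_approx_of_totallyBounded htb (ε ^ 2 / 2) (by positivity)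
  have hts' : ∀ v ∈ t, ∃ w ∈ Metric.closedBall (0 : H) 1, (S ∘L star S) w = v :=
    fun v hv => hts hv
  choose! g hg hgt using hts'
  refine ⟨(fun v => (star S : H →L[ℂ] H) (g v)) '' t, htf.image _, ?_⟩
  rintro _ ⟨u, hu, rfl⟩
  obtain ⟨v, hvt, hv⟩ : ∃ v ∈ t, S (star S u) ∈ Metric.ball v (ε ^ 2 / 2) := by
    simpa using ht ⟨u, hu, rfl⟩
  simp only [Set.mem_iUnion, Set.mem_image]
  refine ⟨_, ⟨v, hvt, rfl⟩, ?_⟩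
  have hu' : ‖u - g v‖ ≤ 2 := by
    have := norm_sub_le u (g v)
    have h1 : ‖u‖ ≤ 1 := by simpa using hu
    have h2 : ‖g v‖ ≤ 1 := by simpa using hg v hvt
    linarith
  have key : ‖(star S : H →L[ℂ] H) (u - g v)‖ ^ 2 < ε ^ 2 := by
    have h1 : ‖S (star S (u - g v))‖ < ε ^ 2 / 2 := by
      have := hgt v hvt
      simp only [ContinuousLinearMap.comp_apply] at this
      rw [map_sub, map_sub, this, ← dist_eq_norm]
      exact hv
    have h2 : ‖(star S : H →L[ℂ] H) (u - g v)‖ ^ 2 ≤ ‖u - g v‖ * ‖S (star S (u - g v))‖ := by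
      rw [ContinuousLinearMap.star_eq_adjoint,
        ContinuousLinearMap.apply_norm_sq_eq_inner_adjoint_right,
        ContinuousLinearMap.adjoint_adjoint]
      exact (RCLike.re_le_norm _).trans (norm_inner_le_norm _ _)
    nlinarith [norm_nonneg (u - g v), norm_nonneg (S (star S (u - g v)))]
  rw [Metric.mem_ball, dist_eq_norm]
  change ‖(star S : H →L[ℂ] H) u - (star S : H →L[ℂ] H) (g v)‖ < ε
  rw [← map_sub]
  exact lt_of_pow_lt_pow_left₀ 2 hε.le key

/-- A Hilbert-Schmidt kernel can be approximated in `L²` by kernels of compact operators. -/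
theorem exists_compact_kernel_eLpNorm_sub_le {Y H : Type*} [MeasurableSpace Y] {μ : Measure Y}
    [NormedAddCommGroup H] [InnerProductSpace ℂ H] {k : Y → H} (hk : MemLp k 2 μ)
    {ε : ENNReal} (hε : ε ≠ 0) :
    ∃ g : Y → H, eLpNorm (k - g) 2 μ ≤ ε ∧ AEStronglyMeasurable g μ ∧
      ∃ T : H →L[ℂ] Lp ℂ 2 μ, IsCompactOperator T ∧
        ∀ u, T u =ᵐ[μ] fun y => inner ℂ (g y) u := by
  refine hk.induction_dense (by simp) (fun g => AEStronglyMeasurable g μ ∧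
      ∃ T : H →L[ℂ] Lp ℂ 2 μ, IsCompactOperator T ∧
        ∀ u, T u =ᵐ[μ] fun y => inner ℂ (g y) u) ?_ ?_ (fun _ h => h.1) hε
  · intro c s hs hμs ε' _
    refine ⟨s.indicator fun _ => c, by simp, (aestronglyMeasurable_const.indicator hs),
      (innerSL ℂ c).smulRight (indicatorConstLp 2 hs hμs.ne 1), ?_, fun u => ?_⟩
    · exact (isCompactOperator_of_locallyCompactSpace_rng
        (ContinuousLinearMap.toSpanSingleton ℂ (indicatorConstLp 2 hs hμs.ne (1 : ℂ)))).comp_clm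
        (innerSL ℂ c)
    · have h1 := Lp.coeFn_smul (inner ℂ c u) (indicatorConstLp 2 hs hμs.ne (1 : ℂ))
      filter_upwards [h1, indicatorConstLp_coeFn (p := 2) (hs := hs) (hμs := hμs.ne) (c := (1 : ℂ))]
        with y hy hy'
      simp only [ContinuousLinearMap.smulRight_apply, innerSL_apply_apply]
      rw [hy, Pi.smul_apply, hy']
      by_cases h : y ∈ s <;> simp [h]
  · rintro f g ⟨hf, T, hT, hTf⟩ ⟨hg, T', hT', hTg⟩
    refine ⟨hf.add hg, T + T', hT.add hT', fun u => ?_⟩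
    filter_upwards [hTf u, hTg u, Lp.coeFn_add (T u) (T' u)] with y h1 h2 h3
    rw [_root_.add_apply, h3, Pi.add_apply, h1, h2, Pi.add_apply, inner_add_left]

section Weyl

variable {n : ℕ} {W : Xi n → (Hn n →L[ℂ] Hn n)}

theorem continuous_translate_Lp (u : Hn n) :
    Continuous fun x : Fin n → ℝ => (DomAddAct.mk (-x) +ᵥ u : Hn n) := by
  have h : Continuous fun x : Fin n → ℝ => (DomAddAct.mk (-x) : (Fin n → ℝ)ᵈᵃᵃ) := by fun_prop
  have : Fact ((2 : ENNReal) ≠ ⊤) := ⟨by norm_num⟩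
  exact h.vadd continuous_const

theorem translate_Lp_ae_eq (x : Fin n → ℝ) (u : Hn n) :
    (DomAddAct.mk (-x) +ᵥ u : Hn n) =ᵐ[volume] fun y => u (y - x) := by
  filter_upwards [DomAddAct.vadd_Lp_ae_eq (DomAddAct.mk (-x)) u] with y hy
  rw [hy]
  simp [neg_add_eq_sub]

theorem norm_exp_I_mul_ofReal (t : ℝ) : ‖Complex.exp (Complex.I * (t : ℂ))‖ = 1 := by
  rw [mul_comm]
  exact Complex.norm_exp_ofReal_mul_I t

namespace IsWeylFamily

theorem translation_ae_eq (hW : IsWeylFamily n W) (x : Fin n → ℝ) (u : Hn n) :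
    W (x, 0) u =ᵐ[volume] fun y => u (y - x) := by
  filter_upwards [hW x 0 u] with y hy
  simp [hy]

theorem modulation_ae_eq (hW : IsWeylFamily n W) (ξ : Fin n → ℝ) (u : Hn n) :
    W (0, ξ) u =ᵐ[volume] fun y => Complex.exp (Complex.I * ((y ⬝ᵥ ξ : ℝ) : ℂ)) * u y := by
  filter_upwards [hW 0 ξ u] with y hy
  simp [hy]

theorem map_zero_eq_one (hW : IsWeylFamily n W) : W (0, 0) = 1 := by
  ext1 u
  apply Lp.ext
  filter_upwards [hW 0 0 u] with y hy
  simp [hy]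

theorem continuous_apply (hW : IsWeylFamily n W) (u : Hn n) : Continuous fun X => W X u := by
  rw [continuous_iff_continuousAt]
  rintro ⟨x₀, ξ₀⟩
  set e : Xi n → (Fin n → ℝ) → ℂ := fun X y =>
    Complex.exp (Complex.I * (((y - (2⁻¹ : ℝ) • X.1) ⬝ᵥ X.2 : ℝ) : ℂ)) with he
  have he1 : ∀ X y, ‖e X y‖ = 1 := fun X y => norm_exp_I_mul_ofReal _
  have hec : Continuous (Function.uncurry e) := by
    simp only [he, Function.uncurry_def, dotProduct]
    fun_prop
  set τ : (Fin n → ℝ) → Hn n := fun x => DomAddAct.mk (-x) +ᵥ u with hτ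
  have hWe : ∀ X, W X u =ᵐ[volume] fun y => e X y * τ X.1 y := fun X => by
    filter_upwards [hW X.1 X.2 u, translate_Lp_ae_eq X.1 u] with y h1 h2
    rw [h1, h2]
  have hlim : Tendsto (fun X => ∫⁻ y, ‖(e X y - e (x₀, ξ₀) y) * τ x₀ y‖ₑ ^ 2)
      (𝓝 (x₀, ξ₀)) (𝓝 0) := by
    have h0 : ∫⁻ _ : Fin n → ℝ, (0 : ENNReal) = 0 := by simp
    rw [← h0]
    refine tendsto_lintegral_filter_of_dominated_convergence (fun y => (2 * ‖τ x₀ y‖ₑ) ^ 2)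
      (Eventually.of_forall fun X => ?_) (Eventually.of_forall fun X => ae_of_all _ fun y => ?_)
      ?_ (ae_of_all _ fun y => ?_)
    · have hm : ∀ X, Measurable (e X) := fun X =>
        (hec.comp (Continuous.prodMk_right X)).measurable
      exact (((hm X).sub (hm _)).mul (Lp.stronglyMeasurable _).measurable).enorm.pow_const 2
    · gcongr
      rw [enorm_mul]
      gcongr
      refine enorm_sub_le.trans ?_
      rw [← ofReal_norm, ← ofReal_norm, he1, he1]
      norm_num
    · simp_rw [mul_pow]
      rw [lintegral_const_mul' _ _ (by norm_num), ← eLpNorm_two_sq_eq_lintegral]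
      exact ENNReal.mul_ne_top (by norm_num) (ENNReal.pow_ne_top (Lp.eLpNorm_ne_top _))
    · have : Continuous fun X => ‖(e X y - e (x₀, ξ₀) y) * τ x₀ y‖ₑ ^ 2 := by
        have : Continuous fun X => e X y := hec.comp (Continuous.prodMk_left y)
        have : Continuous fun X => ‖(e X y - e (x₀, ξ₀) y) * τ x₀ y‖ₑ := by fun_prop
        exact (ENNReal.continuous_pow 2).comp this
      simpa using this.tendsto (x₀, ξ₀)
  have hlim' : Tendsto (fun X => eLpNorm (fun y => (e X y - e (x₀, ξ₀) y) * τ x₀ y) 2 volume)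
      (𝓝 (x₀, ξ₀)) (𝓝 0) := by
    have h := hlim.ennrpow_const (1 / 2)
    rw [ENNReal.zero_rpow_of_pos (by norm_num)] at h
    refine h.congr fun X => ?_
    rw [← eLpNorm_two_sq_eq_lintegral, ← ENNReal.rpow_two, ← ENNReal.rpow_mul]
    norm_num
  rw [ContinuousAt, tendsto_iff_edist_tendsto_0]
  have hτ' : Tendsto (fun X : Xi n => edist (τ X.1) (τ x₀)) (𝓝 (x₀, ξ₀)) (𝓝 0) :=
    tendsto_iff_edist_tendsto_0.1
      (((continuous_translate_Lp u).comp continuous_fst).tendsto (x₀, ξ₀))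
  have hsum := hτ'.add hlim'
  rw [add_zero] at hsum
  refine tendsto_of_tendsto_of_tendsto_of_le_of_le tendsto_const_nhds hsum (fun _ => zero_le)
    fun X => ?_
  change edist (W X u) (W (x₀, ξ₀) u) ≤ edist (τ X.1) (τ x₀) +
    eLpNorm (fun y => (e X y - e (x₀, ξ₀) y) * τ x₀ y) 2 volume
  have hm : ∀ X, AEStronglyMeasurable (e X) volume := fun X =>
    (hec.comp (Continuous.prodMk_right X)).aestronglyMeasurable
  rw [Lp.edist_def, Lp.edist_def]
  calc eLpNorm (⇑(W X u) - ⇑(W (x₀, ξ₀) u)) 2 volume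
      = eLpNorm ((fun y => e X y * (τ X.1 y - τ x₀ y)) +
          fun y => (e X y - e (x₀, ξ₀) y) * τ x₀ y) 2 volume := by
        refine eLpNorm_congr_ae ?_
        filter_upwards [hWe X, hWe (x₀, ξ₀)] with y h1 h2
        simp only [Pi.sub_apply, Pi.add_apply, h1, h2]
        ring
    _ ≤ _ := by
        refine (eLpNorm_add_le ((hm X).mul ((Lp.aestronglyMeasurable _).sub
          (Lp.aestronglyMeasurable _))) (((hm X).sub (hm _)).mul (Lp.aestronglyMeasurable _))
          (by norm_num)).trans ?_
        refine add_le_add_left (eLpNorm_mono fun y => ?_) _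
        rw [Pi.mul_apply, norm_mul, he1, one_mul]

end IsWeylFamily

theorem isProbabilityMeasure_cond_closedBall {δ : ℝ} (hδ : 0 < δ) :
    IsProbabilityMeasure
      (ProbabilityTheory.cond (volume : Measure (Fin n → ℝ)) (Metric.closedBall 0 δ)) :=
  ProbabilityTheory.cond_isProbabilityMeasure_of_finite
    (Metric.measure_closedBall_pos _ _ hδ).ne' measure_closedBall_lt_top.ne

/-- The Riemann-Lebesgue lemma for the uniform probability measure on a ball. -/
theorem tendsto_integral_exp_cond_closedBall (δ : ℝ) :
    Tendsto (fun y : Fin n → ℝ => ∫ ξ, Complex.exp (Complex.I * ((y ⬝ᵥ ξ : ℝ) : ℂ))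
      ∂ProbabilityTheory.cond volume (Metric.closedBall 0 δ)) (cocompact _) (𝓝 0) := by
  set B : Set (Fin n → ℝ) := Metric.closedBall 0 δ
  let L₀ : (Fin n → ℝ) →ₗ[ℝ] (Fin n → ℝ) →ₗ[ℝ] ℝ :=
    (-(2 * Real.pi)⁻¹) • dotProductBilin ℝ ℝ
  let L : (Fin n → ℝ) →ₗ[ℝ] StrongDual ℝ (Fin n → ℝ) :=
    (LinearMap.toContinuousLinearMap.toLinearMap) ∘ₗ L₀
  have hL : ∀ y ξ, L y ξ = -(2 * Real.pi)⁻¹ * (y ⬝ᵥ ξ) := fun y ξ => rfl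
  have hLinj : LinearMap.ker L = ⊥ := by
    rw [LinearMap.ker_eq_bot']
    intro y hy
    have h := hL y y
    rw [hy] at h
    have hpi : -(2 * Real.pi)⁻¹ ≠ 0 := by simp [Real.pi_ne_zero]
    exact dotProduct_self_eq_zero.1 ((mul_eq_zero.1 h.symm).resolve_left hpi)
  have h1 := (tendsto_integral_exp_smul_cocompact (B.indicator fun _ => (1 : ℂ))
    (volume : Measure (Fin n → ℝ))).comp
    (LinearMap.isClosedEmbedding_of_injective hLinj).tendsto_cocompact
  have h2 := h1.const_smul ((volume B)⁻¹.toReal)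
  rw [smul_zero] at h2
  refine h2.congr fun y => ?_
  rw [ProbabilityTheory.cond, integral_smul_measure,
    ← integral_indicator (show MeasurableSet B from Metric.isClosed_closedBall.measurableSet)]
  congr 1
  refine integral_congr_ae (ae_of_all _ fun ξ => ?_)
  by_cases hξ : ξ ∈ B
  · simp only [Set.indicator_of_mem hξ, hL, Circle.smul_def, Real.fourierChar_apply, smul_eq_mul,
      mul_one]
    congr 1
    rw [mul_comm]
    congr 2
    field_simp
  · simp [Set.indicator_of_notMem hξ]

/-- Averages over small translates, written as an inner product in `L²`. -/
theorem inner_translate_indicator_eq_integral (δ : ℝ) (y : Fin n → ℝ) (u : Hn n) :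
    inner ℂ ((((volume (Metric.closedBall (0 : Fin n → ℝ) δ))⁻¹.toReal : ℝ) : ℂ) •
      (DomAddAct.mk (-y) +ᵥ indicatorConstLp 2 (Metric.isClosed_closedBall.measurableSet)
        (measure_closedBall_lt_top (x := (0 : Fin n → ℝ)) (r := δ)).ne (1 : ℂ) : Hn n)) u =
    ∫ x, u (y - x) ∂ProbabilityTheory.cond volume (Metric.closedBall 0 δ) := by
  rw [DomAddAct.mk_vadd_indicatorConstLp, inner_smul_left, L2.inner_indicatorConstLp_one,
    ProbabilityTheory.cond, integral_smul_measure, Complex.conj_ofReal, Complex.real_smul]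
  congr 1
  rw [← integral_indicator Metric.isClosed_closedBall.measurableSet,
    ← integral_indicator (Metric.isClosed_closedBall.measurableSet.preimage
      (measurable_const_vadd (-y))), ← integral_sub_left_eq_self _ _ y]
  refine integral_congr_ae (ae_of_all _ fun x => ?_)
  simp [Set.indicator]

namespace IsWeylFamily

/-- Functions in `L²` almost fixed by small translations and small modulations are approximated
by the image of one Hilbert-Schmidt kernel. -/
theorem exists_memLp_kernel_approx (hW : IsWeylFamily n W) {δ : ℝ} (hδ : 0 < δ) :
    ∃ k : (Fin n → ℝ) → Hn n, MemLp k 2 volume ∧ ∀ (u : Hn n) (ε : ENNReal),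
      (∀ x ∈ Metric.closedBall 0 δ, ‖W (x, 0) u - u‖ₑ ≤ ε) →
      (∀ ξ ∈ Metric.closedBall 0 δ, ‖W (0, ξ) u - u‖ₑ ≤ ε) →
      eLpNorm (fun y => u y - inner ℂ (k y) u) 2 volume ≤ 3 * ε := by
  set ν := ProbabilityTheory.cond (volume : Measure (Fin n → ℝ)) (Metric.closedBall 0 δ) with hν
  have : IsProbabilityMeasure ν := isProbabilityMeasure_cond_closedBall hδ
  have hνB : ∀ᵐ x ∂ν, x ∈ Metric.closedBall 0 δ :=
    ProbabilityTheory.ae_cond_mem Metric.isClosed_closedBall.measurableSet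
  set m : (Fin n → ℝ) → ℂ := fun y => ∫ ξ, Complex.exp (Complex.I * ((y ⬝ᵥ ξ : ℝ) : ℂ)) ∂ν with hm
  obtain ⟨K, hK, hKm⟩ : ∃ K : Set (Fin n → ℝ), IsCompact K ∧ ∀ y ∉ K, ‖m y‖ < 1 / 2 := by
    have h := (tendsto_integral_exp_cond_closedBall (n := n) δ).eventually
      (Metric.ball_mem_nhds (0 : ℂ) (by norm_num : (0 : ℝ) < 1 / 2))
    obtain ⟨K, hK, h⟩ := hasBasis_cocompact.eventually_iff.1 h
    exact ⟨K, hK, fun y hy => by simpa using h hy⟩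
  set k₀ : (Fin n → ℝ) → Hn n := fun y =>
    ((((volume (Metric.closedBall (0 : Fin n → ℝ) δ))⁻¹.toReal : ℝ) : ℂ) •
      (DomAddAct.mk (-y) +ᵥ indicatorConstLp 2 (Metric.isClosed_closedBall.measurableSet)
        (measure_closedBall_lt_top (x := (0 : Fin n → ℝ)) (r := δ)).ne (1 : ℂ) : Hn n)) with hk₀
  have hk₀c : Continuous k₀ := (continuous_translate_Lp _).fun_const_smul _
  have hk₀m : MemLp (K.indicator k₀) 2 volume := by
    rw [memLp_indicator_iff_restrict hK.measurableSet]
    obtain ⟨C, hC⟩ := hK.exists_bound_of_continuousOn hk₀c.continuousOn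
    have : IsFiniteMeasure (volume.restrict K) := ⟨by simpa using hK.measure_lt_top⟩
    exact MemLp.of_bound hk₀c.aestronglyMeasurable C
      ((ae_restrict_iff' hK.measurableSet).2 (ae_of_all _ hC))
  refine ⟨K.indicator k₀, hk₀m, fun u ε hx hξ => ?_⟩
  have hum : StronglyMeasurable (u : (Fin n → ℝ) → ℂ) := Lp.stronglyMeasurable u
  have hexp : Continuous fun p : (Fin n → ℝ) × (Fin n → ℝ) =>
      Complex.exp (Complex.I * ((p.2 ⬝ᵥ p.1 : ℝ) : ℂ)) := by
    simp only [dotProduct]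
    fun_prop
  have htrans : eLpNorm (fun y => ∫ x, (u (y - x) - u y) ∂ν) 2 volume ≤ ε := by
    refine eLpNorm_integral_le_of_forall_eLpNorm_le ?_ ?_
    · exact (hum.comp_measurable (measurable_snd.sub measurable_fst)).sub
        (hum.comp_measurable measurable_snd)
    · filter_upwards [hνB] with x hxB
      refine le_trans (le_of_eq ?_) (hx x hxB)
      rw [Lp.enorm_def]
      refine eLpNorm_congr_ae ?_
      filter_upwards [hW.translation_ae_eq x u, Lp.coeFn_sub (W (x, 0) u) u] with y h1 h2
      rw [h2, Pi.sub_apply, h1]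
  have hmod : eLpNorm (fun y => ∫ ξ, (Complex.exp (Complex.I * ((y ⬝ᵥ ξ : ℝ) : ℂ)) - 1) * u y ∂ν)
      2 volume ≤ ε := by
    refine eLpNorm_integral_le_of_forall_eLpNorm_le ?_ ?_
    · exact (hexp.stronglyMeasurable.sub stronglyMeasurable_const).mul
        (hum.comp_measurable measurable_snd)
    · filter_upwards [hνB] with ξ hξB
      refine le_trans (le_of_eq ?_) (hξ ξ hξB)
      rw [Lp.enorm_def]
      refine eLpNorm_congr_ae ?_
      filter_upwards [hW.modulation_ae_eq ξ u, Lp.coeFn_sub (W (0, ξ) u) u] with y h1 h2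
      rw [h2, Pi.sub_apply, h1]
      ring
  have htrans' : ∀ y, ∫ x, (u (y - x) - u y) ∂ν = inner ℂ (k₀ y) u - u y := fun y => by
    have hi : Integrable (fun x => u (y - x)) ν := by
      have h1 : MemLp (fun x => u (y - x)) 2 (volume : Measure (Fin n → ℝ)) :=
        (Lp.memLp u).comp_measurePreserving (Measure.measurePreserving_sub_left volume y)
      have h2 : MemLp (fun x => u (y - x)) 2 ν :=
        (h1.restrict _).smul_measure
          (ENNReal.inv_ne_top.2 (Metric.measure_closedBall_pos _ _ hδ).ne')
      exact h2.integrable (by norm_num)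
    rw [integral_sub hi (integrable_const _), hk₀, inner_translate_indicator_eq_integral]
    simp [hν]
  have hmod' : ∀ y, ∫ ξ, (Complex.exp (Complex.I * ((y ⬝ᵥ ξ : ℝ) : ℂ)) - 1) * u y ∂ν =
      (m y - 1) * u y := fun y => by
    have hi : Integrable (fun ξ => Complex.exp (Complex.I * ((y ⬝ᵥ ξ : ℝ) : ℂ))) ν :=
      Integrable.of_bound (hexp.comp (Continuous.prodMk_left y)).aestronglyMeasurable 1
        (ae_of_all _ fun ξ => (norm_exp_I_mul_ofReal _).le)
    rw [integral_mul_const, integral_sub hi (integrable_const _)]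
    simp [hm]
  simp_rw [htrans'] at htrans
  simp_rw [hmod'] at hmod
  have hmm : AEStronglyMeasurable m volume :=
    hexp.stronglyMeasurable.integral_prod_left'.aestronglyMeasurable
  have hM1 : AEStronglyMeasurable (fun y => inner ℂ (k₀ y) u - u y) volume :=
    (hk₀c.inner continuous_const).aestronglyMeasurable.sub (Lp.aestronglyMeasurable u)
  have hM2 : AEStronglyMeasurable (fun y => (m y - 1) * u y) volume :=
    (hmm.sub aestronglyMeasurable_const).mul (Lp.aestronglyMeasurable u)
  calc eLpNorm (fun y => u y - inner ℂ (K.indicator k₀ y) u) 2 volume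
      ≤ eLpNorm ((fun y => ‖inner ℂ (k₀ y) u - u y‖) + fun y => 2 * ‖(m y - 1) * u y‖)
          2 volume := by
        refine eLpNorm_mono_real fun y => ?_
        rw [Pi.add_apply]
        by_cases hy : y ∈ K
        · rw [Set.indicator_of_mem hy, norm_sub_rev]
          have := norm_nonneg ((m y - 1) * u y)
          linarith
        · rw [Set.indicator_of_notMem hy, inner_zero_left, sub_zero, norm_mul]
          have h1 : 1 / 2 ≤ ‖m y - 1‖ := by
            have := norm_sub_norm_le (1 : ℂ) (m y)
            rw [norm_one, norm_sub_rev] at this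
            linarith [hKm y hy]
          nlinarith [norm_nonneg (u y), norm_nonneg (inner ℂ (k₀ y) u - u y)]
    _ ≤ ε + 2 * ε := by
        refine (eLpNorm_add_le hM1.norm (hM2.norm.const_mul 2) (by norm_num)).trans ?_
        rw [eLpNorm_norm]
        gcongr
        refine (eLpNorm_le_mul_eLpNorm_of_ae_le_mul (c := 2) (g := fun y => (m y - 1) * u y)
          (ae_of_all _ fun y => by simp) 2).trans ?_
        rw [ENNReal.ofReal_ofNat]
        gcongr
    _ = 3 * ε := by ring

theorem isCompactOperator_of_tendsto (hW : IsWeylFamily n W) {S : Hn n →L[ℂ] Hn n}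
    (hE : Tendsto (fun x : Fin n → ℝ => ‖W (x, 0) * S - S‖) (𝓝 0) (𝓝 0))
    (hF : Tendsto (fun ξ : Fin n → ℝ => ‖W (0, ξ) * S - S‖) (𝓝 0) (𝓝 0)) :
    IsCompactOperator S := by
  have hcl : IsClosed {T : Hn n →L[ℂ] Hn n | IsCompactOperator T} :=
    isClosed_setOfPred_isCompactOperator
  refine hcl.closure_subset (Metric.mem_closure_iff.2 fun ε hε => ?_)
  set η : ℝ := ε / (2 * (3 + ‖S‖)) with hη
  have hS0 := norm_nonneg S
  have hη0 : 0 < η := by positivity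
  obtain ⟨δ, hδ, hδη⟩ : ∃ δ > 0, ∀ x ∈ Metric.closedBall (0 : Fin n → ℝ) δ,
      ‖W (x, 0) * S - S‖ < η ∧ ‖W (0, x) * S - S‖ < η := by
    have h := (hE.eventually (gt_mem_nhds hη0)).and (hF.eventually (gt_mem_nhds hη0))
    exact Metric.nhds_basis_closedBall.eventually_iff.1 h
  obtain ⟨k, hk, hku⟩ := hW.exists_memLp_kernel_approx hδ
  obtain ⟨g, hg, hgm, T, hT, hTg⟩ := exists_compact_kernel_eLpNorm_sub_le hk
    (ε := ENNReal.ofReal η) (by simpa using hη0)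
  refine ⟨T * S, hT.comp_clm S, ?_⟩
  rw [dist_eq_norm]
  have hbound : ‖S - T * S‖ ≤ (3 + ‖S‖) * η := by
    refine ContinuousLinearMap.opNorm_le_of_unit_norm (by positivity) fun u hu => ?_
    have hop : ∀ V : Hn n →L[ℂ] Hn n, ‖V * S - S‖ < η →
        ‖V (S u) - S u‖ₑ ≤ ENNReal.ofReal η := fun V hV => by
      rw [← ofReal_norm]
      refine ENNReal.ofReal_le_ofReal ?_
      have := (V * S - S).le_opNorm u
      rw [hu, mul_one] at this
      exact this.trans hV.le
    have h1 := hku (S u) (ENNReal.ofReal η) (fun x hx => hop _ (hδη x hx).1)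
      (fun x hx => hop _ (hδη x hx).2)
    have h2 : eLpNorm (fun y => inner ℂ ((k - g) y) (S u)) 2 volume ≤
        ENNReal.ofReal ‖S‖ * ENNReal.ofReal η := by
      refine (eLpNorm_le_mul_eLpNorm_of_ae_le_mul (c := ‖S‖) (g := k - g)
        (ae_of_all _ fun y => ?_) 2).trans (by gcongr)
      refine (norm_inner_le_norm _ _).trans ?_
      rw [mul_comm]
      gcongr
      simpa [hu] using S.le_opNorm u
    have h3 : ‖(S - T * S) u‖ₑ ≤ ENNReal.ofReal ((3 + ‖S‖) * η) := by
      rw [Lp.enorm_def]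
      calc eLpNorm ((S - T * S) u) 2 volume
          = eLpNorm ((fun y => S u y - inner ℂ (k y) (S u)) +
              fun y => inner ℂ ((k - g) y) (S u)) 2 volume := by
            refine eLpNorm_congr_ae ?_
            filter_upwards [Lp.coeFn_sub (S u) (T (S u)), hTg (S u)] with y e1 e2
            change (S u - T (S u) : Hn n) y = _
            rw [e1, Pi.sub_apply, e2, Pi.add_apply, Pi.sub_apply, inner_sub_left]
            ring
        _ ≤ 3 * ENNReal.ofReal η + ENNReal.ofReal ‖S‖ * ENNReal.ofReal η := by
            refine (eLpNorm_add_le ?_ ?_ (by norm_num)).trans (add_le_add h1 h2)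
            · exact (Lp.aestronglyMeasurable _).sub (hk.1.inner aestronglyMeasurable_const)
            · exact (hk.1.sub hgm).inner aestronglyMeasurable_const
        _ = ENNReal.ofReal ((3 + ‖S‖) * η) := by
            rw [ENNReal.ofReal_mul (by positivity), ENNReal.ofReal_add (by norm_num) hS0,
              ENNReal.ofReal_ofNat, add_mul]
    rw [← ofReal_norm] at h3
    exact (ENNReal.ofReal_le_ofReal_iff (by positivity)).1 h3
  refine hbound.trans_lt ?_
  rw [hη]
  field_simp
  linarith

theorem continuous_mul (hW : IsWeylFamily n W) (hWU : ∀ X, W X ∈ unitary (Hn n →L[ℂ] Hn n))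
    {S : Hn n →L[ℂ] Hn n} (hS : IsCompactOperator S) : Continuous fun X => W X * S :=
  continuous_mul_of_isCompactOperator
    (fun X u => (ContinuousLinearMap.norm_map_of_mem_unitary (hWU X) u).le)
    hW.continuous_apply hS

theorem mem_B0_of_isCompactOperator (hW : IsWeylFamily n W)
    (hWU : ∀ X, W X ∈ unitary (Hn n →L[ℂ] Hn n)) {S : Hn n →L[ℂ] Hn n}
    (hS : IsCompactOperator S) : S ∈ B0 n W := by
  have h1 := hW.continuous_mul hWU hS
  have h2 := (hW.continuous_mul hWU (isCompactOperator_star hS)).star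
  simp only [star_mul, star_star] at h2
  change Continuous fun X => W X * S * star (W X)
  rw [continuous_iff_continuousAt]
  intro X₀
  rw [ContinuousAt, tendsto_iff_norm_sub_tendsto_zero]
  have h1' := tendsto_iff_norm_sub_tendsto_zero.1 (h1.tendsto X₀)
  have h2' := tendsto_iff_norm_sub_tendsto_zero.1 (h2.tendsto X₀)
  have h := h1'.add h2'
  rw [add_zero] at h
  refine squeeze_zero (fun _ => norm_nonneg _) (fun X => ?_) h
  have e : W X * S * star (W X) - W X₀ * S * star (W X₀) =
      (W X * S - W X₀ * S) * star (W X) + W X₀ * (S * star (W X) - S * star (W X₀)) := by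
    noncomm_ring
  rw [e]
  refine (norm_add_le _ _).trans (le_of_eq ?_)
  rw [CStarRing.norm_mul_mem_unitary _ (Unitary.star_mem (hWU X)),
    CStarRing.norm_mem_unitary_mul _ (hWU X₀)]

theorem tendsto_norm_mul_sub (hW : IsWeylFamily n W)
    (hWU : ∀ X, W X ∈ unitary (Hn n →L[ℂ] Hn n)) {S : Hn n →L[ℂ] Hn n}
    (hS : IsCompactOperator S) {f : (Fin n → ℝ) → Xi n} (hf : Continuous f) (hf0 : f 0 = (0, 0)) :
    Tendsto (fun x => ‖W (f x) * S - S‖) (𝓝 0) (𝓝 0) := by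
  have h := tendsto_iff_norm_sub_tendsto_zero.1 (((hW.continuous_mul hWU hS).comp hf).tendsto 0)
  simpa [hf0, hW.map_zero_eq_one] using h

end IsWeylFamily

end Weyl

/-- `E(H) ∩ F(H)` is exactly the ideal of compact operators:
`S` is compact iff `S ∈ B⁰(H)`, `‖W(x,0)S⁽*⁾ - S⁽*⁾‖ → 0` as `x → 0` and
`‖W(0,ξ)S⁽*⁾ - S⁽*⁾‖ → 0` as `ξ → 0`. -/
theorem statement11 (n : ℕ) (W : Xi n → (Hn n →L[ℂ] Hn n))
    (hW : IsWeylFamily n W) (hWU : ∀ X : Xi n, W X ∈ unitary (Hn n →L[ℂ] Hn n))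
    (S : Hn n →L[ℂ] Hn n) :
    (S ∈ B0 n W ∧
      (Tendsto (fun x : Fin n → ℝ => ‖W (x, 0) * S - S‖) (𝓝 0) (𝓝 0) ∧
       Tendsto (fun x : Fin n → ℝ => ‖W (x, 0) * star S - star S‖) (𝓝 0) (𝓝 0)) ∧
      (Tendsto (fun ξ : Fin n → ℝ => ‖W (0, ξ) * S - S‖) (𝓝 0) (𝓝 0) ∧
       Tendsto (fun ξ : Fin n → ℝ => ‖W (0, ξ) * star S - star S‖) (𝓝 0) (𝓝 0)))
    ↔ IsCompactOperator (⇑S) := by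
  refine ⟨fun h => hW.isCompactOperator_of_tendsto h.2.1.1 h.2.2.1, fun hS => ?_⟩
  have hS' := isCompactOperator_star hS
  have hE : Continuous fun x : Fin n → ℝ => ((x, 0) : Xi n) := by fun_prop
  have hF : Continuous fun ξ : Fin n → ℝ => ((0, ξ) : Xi n) := by fun_prop
  exact ⟨hW.mem_B0_of_isCompactOperator hWU hS,
    ⟨hW.tendsto_norm_mul_sub hWU hS hE rfl, hW.tendsto_norm_mul_sub hWU hS' hE rfl⟩,
    ⟨hW.tendsto_norm_mul_sub hWU hS hF rfl, hW.tendsto_norm_mul_sub hWU hS' hF rfl⟩⟩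
end
end

section
/- E(H) is a two-sided ideal in B⁰(H): if S ∈ B⁰(H) and T ∈ E(H), then both S T and T S belong to E(H); moreover E(H) is a closed *-subalgebra of B⁰(H). -/
open MeasureTheory Filter Topology Matrix
open scoped Pointwise

noncomputable section

/-- `E(H) = {S ∈ B⁰(H) : ‖W(x,0)S⁽*⁾ - S⁽*⁾‖ → 0 as x → 0}`. -/
def EH (n : ℕ) (W : Xi n → (Hn n →L[ℂ] Hn n)) : Set (Hn n →L[ℂ] Hn n) :=
  {S | S ∈ B0 n W ∧
    Tendsto (fun x : Fin n → ℝ => ‖W (x, 0) * S - S‖) (𝓝 0) (𝓝 0) ∧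
    Tendsto (fun x : Fin n → ℝ => ‖W (x, 0) * star S - star S‖) (𝓝 0) (𝓝 0)}

/-- For a family of 1-Lipschitz maps, continuity at a point is a closed condition on the argument. -/
theorem isClosed_setOf_continuousAt_of_dist_le {X A B : Type*} [TopologicalSpace X]
    [PseudoMetricSpace A] [PseudoMetricSpace B] (F : X → A → B)
    (hF : ∀ x a b, dist (F x a) (F x b) ≤ dist a b) (x₀ : X) :
    IsClosed {a | ContinuousAt (fun x => F x a) x₀} := by
  refine isClosed_of_closure_subset fun a ha => ?_
  refine continuousAt_of_locally_uniform_approx_of_continuousAt (f := fun x => F x a) fun u hu => ?_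
  obtain ⟨ε, hε, hεu⟩ := Metric.mem_uniformity_dist.1 hu
  obtain ⟨b, hb, hab⟩ := Metric.mem_closure_iff.1 ha ε hε
  refine ⟨Set.univ, univ_mem, fun x => F x b, hb, fun y _ => ?_⟩
  exact hεu ((hF y a b).trans_lt hab)

section Weyl

variable {n : ℕ} {W : Xi n → (Hn n →L[ℂ] Hn n)}

theorem IsWeylFamily.map_zero (hW : IsWeylFamily n W) : W (0, 0) = 1 := by
  ext1 u
  refine Lp.ext ?_
  filter_upwards [hW 0 0 u] with y hy
  simpa using hy

theorem Tconj_zero (hW : IsWeylFamily n W) (S : Hn n →L[ℂ] Hn n) : Tconj n W (0, 0) S = S := by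
  simp [Tconj, hW.map_zero]

theorem Tconj_mul {X : Xi n} (hX : W X ∈ unitary (Hn n →L[ℂ] Hn n)) (S T : Hn n →L[ℂ] Hn n) :
    Tconj n W X (S * T) = Tconj n W X S * Tconj n W X T := by
  have h : star (W X) * W X = 1 := Unitary.star_mul_self_of_mem hX
  calc W X * (S * T) * star (W X) = W X * S * 1 * T * star (W X) := by simp only [mul_assoc, one_mul]
    _ = W X * S * star (W X) * (W X * T * star (W X)) := by rw [← h]; simp only [mul_assoc]

theorem Tconj_star (X : Xi n) (S : Hn n →L[ℂ] Hn n) :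
    Tconj n W X (star S) = star (Tconj n W X S) := by
  simp [Tconj, mul_assoc]

theorem Tconj_mul_self {X : Xi n} (hX : W X ∈ unitary (Hn n →L[ℂ] Hn n))
    (S : Hn n →L[ℂ] Hn n) : Tconj n W X S * W X = W X * S := by
  rw [Tconj, mul_assoc, Unitary.star_mul_self_of_mem hX, mul_one]

theorem mul_mem_B0 (hWU : ∀ X : Xi n, W X ∈ unitary (Hn n →L[ℂ] Hn n))
    {S T : Hn n →L[ℂ] Hn n} (hS : S ∈ B0 n W) (hT : T ∈ B0 n W) : S * T ∈ B0 n W := by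
  have h : (fun X => Tconj n W X (S * T)) = fun X => Tconj n W X S * Tconj n W X T :=
    funext fun X => Tconj_mul (hWU X) S T
  simpa only [B0, Set.mem_ofPred_eq, h] using Continuous.fun_mul hS hT

theorem star_mem_B0 {S : Hn n →L[ℂ] Hn n} (hS : S ∈ B0 n W) : star S ∈ B0 n W := by
  simpa only [B0, Set.mem_ofPred_eq, Tconj_star] using Continuous.star hS

theorem add_mem_B0 {S T : Hn n →L[ℂ] Hn n} (hS : S ∈ B0 n W) (hT : T ∈ B0 n W) :
    S + T ∈ B0 n W := by
  simpa only [B0, Set.mem_ofPred_eq, Tconj, mul_add, add_mul] using Continuous.fun_add hS hT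

theorem smul_mem_B0 (c : ℂ) {S : Hn n →L[ℂ] Hn n} (hS : S ∈ B0 n W) : c • S ∈ B0 n W := by
  simpa only [B0, Set.mem_ofPred_eq, Tconj, mul_smul_comm, smul_mul_assoc]
    using Continuous.fun_const_smul hS c

theorem isClosed_B0 (hWU : ∀ X : Xi n, W X ∈ unitary (Hn n →L[ℂ] Hn n)) :
    IsClosed (B0 n W) := by
  simp only [B0, continuous_iff_continuousAt, Set.ofPred_forall]
  refine isClosed_iInter fun X₀ => isClosed_setOf_continuousAt_of_dist_le _ (fun X S T => ?_) X₀
  rw [dist_eq_norm, dist_eq_norm, Tconj, Tconj, ← sub_mul, ← mul_sub,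
    CStarRing.norm_mul_mem_unitary _ (Unitary.star_mem (hWU X)),
    CStarRing.norm_mem_unitary_mul _ (hWU X)]

theorem mem_EH_iff {S : Hn n →L[ℂ] Hn n} :
    S ∈ EH n W ↔ S ∈ B0 n W ∧
      Tendsto (fun x : Fin n → ℝ => W (x, 0) * S) (𝓝 0) (𝓝 S) ∧
      Tendsto (fun x : Fin n → ℝ => W (x, 0) * star S) (𝓝 0) (𝓝 (star S)) := by
  rw [tendsto_iff_norm_sub_tendsto_zero (b := S), tendsto_iff_norm_sub_tendsto_zero (b := star S)]
  rfl

theorem star_mem_EH {S : Hn n →L[ℂ] Hn n} (hS : S ∈ EH n W) : star S ∈ EH n W :=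
  ⟨star_mem_B0 hS.1, hS.2.2, by simpa only [star_star] using hS.2.1⟩

theorem mul_mem_EH (hW : IsWeylFamily n W) (hWU : ∀ X : Xi n, W X ∈ unitary (Hn n →L[ℂ] Hn n))
    {S T : Hn n →L[ℂ] Hn n} (hS : S ∈ B0 n W) (hT : T ∈ EH n W) : S * T ∈ EH n W := by
  rw [mem_EH_iff] at hT ⊢
  refine ⟨mul_mem_B0 hWU hS hT.1, ?_, ?_⟩
  · have hS₀ : Tendsto (fun x : Fin n → ℝ => Tconj n W (x, 0) S) (𝓝 0) (𝓝 S) := by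
      have h : Continuous fun x : Fin n → ℝ => Tconj n W (x, 0) S :=
        Continuous.comp (g := fun X : Xi n => Tconj n W X S) hS (by fun_prop)
      simpa only [Tconj_zero hW] using h.tendsto 0
    refine (hS₀.mul hT.2.1).congr fun x => ?_
    rw [← mul_assoc, Tconj_mul_self (hWU _), mul_assoc]
  · simpa only [star_mul, mul_assoc] using hT.2.2.mul_const (star S)

theorem add_mem_EH {S T : Hn n →L[ℂ] Hn n} (hS : S ∈ EH n W) (hT : T ∈ EH n W) :
    S + T ∈ EH n W := by
  rw [mem_EH_iff] at hS hT ⊢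
  exact ⟨add_mem_B0 hS.1 hT.1, by simpa only [mul_add] using hS.2.1.add hT.2.1,
    by simpa only [star_add, mul_add] using hS.2.2.add hT.2.2⟩

theorem smul_mem_EH (c : ℂ) {S : Hn n →L[ℂ] Hn n} (hS : S ∈ EH n W) : c • S ∈ EH n W := by
  rw [mem_EH_iff] at hS ⊢
  exact ⟨smul_mem_B0 c hS.1, by simpa only [mul_smul_comm] using hS.2.1.const_smul c,
    by simpa only [star_smul, mul_smul_comm] using hS.2.2.const_smul (star c)⟩

theorem isClosed_EH (hW : IsWeylFamily n W)
    (hWU : ∀ X : Xi n, W X ∈ unitary (Hn n →L[ℂ] Hn n)) : IsClosed (EH n W) := by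
  have hcl : IsClosed {S : Hn n →L[ℂ] Hn n |
      ContinuousAt (fun x : Fin n → ℝ => W (x, 0) * S) 0} :=
    isClosed_setOf_continuousAt_of_dist_le _ (fun x S T => by
      rw [dist_eq_norm, dist_eq_norm, ← mul_sub, CStarRing.norm_mem_unitary_mul _ (hWU _)]) 0
  convert (isClosed_B0 hWU).inter (hcl.inter (hcl.preimage continuous_star)) using 1
  ext S
  simp only [mem_EH_iff, ContinuousAt, hW.map_zero, one_mul, Set.mem_inter_iff,
    Set.mem_preimage, Set.mem_ofPred_eq]

end Weyl

/-- `E(H)` is a closed two-sided *-ideal of `B⁰(H)`. -/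
theorem statement12 (n : ℕ) (W : Xi n → (Hn n →L[ℂ] Hn n))
    (hW : IsWeylFamily n W) (hWU : ∀ X : Xi n, W X ∈ unitary (Hn n →L[ℂ] Hn n)) :
    (∀ S ∈ B0 n W, ∀ T ∈ EH n W, S * T ∈ EH n W ∧ T * S ∈ EH n W) ∧
    (∀ T ∈ EH n W, ∀ T' ∈ EH n W, T + T' ∈ EH n W) ∧
    (∀ (c : ℂ), ∀ T ∈ EH n W, c • T ∈ EH n W) ∧
    (∀ T ∈ EH n W, star T ∈ EH n W) ∧
    IsClosed (EH n W) := by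
  refine ⟨fun S hS T hT => ⟨mul_mem_EH hW hWU hS hT, ?_⟩, fun T hT T' hT' => add_mem_EH hT hT',
    fun c T hT => smul_mem_EH c hT, fun T hT => star_mem_EH hT, isClosed_EH hW hWU⟩
  simpa only [star_mul, star_star] using
    star_mem_EH (mul_mem_EH hW hWU (star_mem_B0 hS) (star_mem_EH hT))
end
end
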